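/- (Lack of bias of augmented resampling.) Under (A1) with g ∈ B_+(X) bounded and strictly positive, for any X^N-valued random variable ξ_0 and bounded measurable φ, the output ξ_S of given ξ_0 satisfies E[ (1/N)Σ_{i=1}^N φ(ξ_S^i) | ξ_0 ] = (Σ_i g(ξ_0^i)φ(ξ_0^i)) / (Σ_i g(ξ_0^i)) almost surely. -/

import Mathlib

open Matrix Kronecker

/-- The k×k all-ones matrix. -/
noncomputable def J (k : ℕ) : Matrix (Fin k) (Fin k) ℝ := Matrix.of fun _ _ => 1

/-- The matrix `A_s := I_{2^{S-s}} ⊗ (1/2)J_2 ⊗ I_{2^{s-1}} ⊗ (1/M)J_M`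
on the product index type. -/
noncomputable def Akron (S M s : ℕ) :
    Matrix (((Fin (2^(S-s)) × Fin 2) × Fin (2^(s-1))) × Fin M)
           (((Fin (2^(S-s)) × Fin 2) × Fin (2^(s-1))) × Fin M) ℝ :=
  (((1 : Matrix (Fin (2^(S-s))) (Fin (2^(S-s))) ℝ) ⊗ₖ ((1/2 : ℝ) • J 2)) ⊗ₖ
      (1 : Matrix (Fin (2^(s-1))) (Fin (2^(s-1))) ℝ)) ⊗ₖ ((1/(M:ℝ)) • J M)

/-- Flattening equivalence for a triple Kronecker product (row-major order). -/
def bEquiv (a b c : ℕ) : (Fin a × Fin b) × Fin c ≃ Fin (a * b * c) :=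
  (finProdFinEquiv.prodCongr (Equiv.refl (Fin c))).trans finProdFinEquiv

/-- Flattening equivalence for a fourfold Kronecker product (row-major order). -/
def aEquiv (a b c d : ℕ) : ((Fin a × Fin b) × Fin c) × Fin d ≃ Fin (a * b * c * d) :=
  ((bEquiv a b c).prodCongr (Equiv.refl (Fin d))).trans finProdFinEquiv

lemma size_eq (S s M : ℕ) (h1 : 1 ≤ s) (h2 : s ≤ S) :
    2^(S-s) * 2 * 2^(s-1) * M = 2^S * M := by
  have hS : S - s + (s - 1) + 1 = S := by omega
  calc 2^(S-s) * 2 * 2^(s-1) * M = (2^(S-s) * 2^(s-1) * 2^1) * M := by ring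
    _ = 2^(S - s + (s-1) + 1) * M := by rw [pow_add, pow_add]
    _ = 2^S * M := by rw [hS]

/-- The matrix `A_s` viewed as an `N × N` matrix, `N = 2^S·M`, with the rows and
columns ordered consistently with the Kronecker (row-major) structure. -/
noncomputable def Amat (S M s : ℕ) : Matrix (Fin (2^S * M)) (Fin (2^S * M)) ℝ :=
  if h : 1 ≤ s ∧ s ≤ S then
    Matrix.reindex
      ((aEquiv (2^(S-s)) 2 (2^(s-1)) M).trans (finCongr (size_eq S s M h.1 h.2)))
      ((aEquiv (2^(S-s)) 2 (2^(s-1)) M).trans (finCongr (size_eq S s M h.1 h.2)))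
      (Akron S M s)
  else 0


open MeasureTheory

lemma e_val (S M s : ℕ) (h : 1 ≤ s ∧ s ≤ S) (a : Fin (2^(S-s))) (b : Fin 2) (c : Fin (2^(s-1)))
    (d : Fin M) :
    ((((aEquiv (2^(S-s)) 2 (2^(s-1)) M).trans (finCongr (size_eq S s M h.1 h.2)))
      (((a, b), c), d) : Fin (2^S * M)) : ℕ) = d + M * (c + 2^(s-1) * (b + 2 * a)) := by
  simp [aEquiv, bEquiv, finProdFinEquiv]

lemma Amat_symm (S M s : ℕ) (i j : Fin (2^S * M)) : Amat S M s i j = Amat S M s j i := by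
  unfold Amat
  split_ifs with h
  · simp only [Akron, Matrix.one_apply, _root_.J, Matrix.kroneckerMap_apply, Matrix.reindex_apply,
      Matrix.submatrix_apply, Matrix.smul_apply, Matrix.of_apply, smul_eq_mul]
    generalize ((aEquiv (2^(S-s)) 2 (2^(s-1)) M).trans
      (finCongr (size_eq S s M h.1 h.2))).symm i = x
    generalize ((aEquiv (2^(S-s)) 2 (2^(s-1)) M).trans
      (finCongr (size_eq S s M h.1 h.2))).symm j = y
    simp only [eq_comm (a := x.1.1.1), eq_comm (a := x.1.2)]
  · rfl

lemma Amat_nonneg (S M s : ℕ) (i j : Fin (2^S * M)) : 0 ≤ Amat S M s i j := by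
  unfold Amat
  split_ifs with h
  · simp only [Akron, Matrix.one_apply, _root_.J, Matrix.kroneckerMap_apply, Matrix.reindex_apply,
      Matrix.submatrix_apply, Matrix.smul_apply, Matrix.of_apply, smul_eq_mul]
    positivity
  · simp

lemma Amat_sum (S M s : ℕ) (h : 1 ≤ s ∧ s ≤ S) (f : Fin (2^S * M) → ℝ)
    (a : Fin (2^(S-s))) (b : Fin 2) (c : Fin (2^(s-1))) (d : Fin M) :
    ∑ j, Amat S M s (((aEquiv (2^(S-s)) 2 (2^(s-1)) M).trans
      (finCongr (size_eq S s M h.1 h.2))) (((a, b), c), d)) j * f j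
    = ∑ b' : Fin 2, ∑ d' : Fin M, (1 / 2 * (1 / (M:ℝ))) *
      f (((aEquiv (2^(S-s)) 2 (2^(s-1)) M).trans
      (finCongr (size_eq S s M h.1 h.2))) (((a, b'), c), d')) := by
  rw [← ((aEquiv (2^(S-s)) 2 (2^(s-1)) M).trans
      (finCongr (size_eq S s M h.1 h.2))).sum_comp]
  rw [Amat, dif_pos h]
  simp only [Matrix.reindex_apply, Matrix.submatrix_apply, Equiv.symm_apply_apply]
  generalize ((aEquiv (2^(S-s)) 2 (2^(s-1)) M).trans
      (finCongr (size_eq S s M h.1 h.2))) = e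
  simp only [Fintype.sum_prod_type, Akron, Matrix.one_apply, _root_.J, Matrix.kroneckerMap_apply,
    Matrix.smul_apply, Matrix.of_apply, smul_eq_mul, ite_mul, mul_ite, one_mul, zero_mul, mul_one,
    mul_zero]
  rw [Finset.sum_eq_single a]
  · refine Finset.sum_congr rfl fun b' _ => ?_
    rw [Finset.sum_eq_single c]
    · simp
    · intro c' _ hc
      simp [hc.symm]
    · simp
  · intro a' _ ha
    simp [ha.symm]
  · simp

lemma Amat_row (S M s : ℕ) (hM : 0 < M) (h : 1 ≤ s ∧ s ≤ S) (i : Fin (2^S * M)) :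
    ∑ j, Amat S M s i j = 1 := by
  obtain ⟨⟨⟨⟨a, b⟩, c⟩, d⟩, rfl⟩ := ((aEquiv (2^(S-s)) 2 (2^(s-1)) M).trans
      (finCongr (size_eq S s M h.1 h.2))).surjective i
  have := Amat_sum S M s h (fun _ => 1) a b c d
  simp only [mul_one] at this
  rw [this]
  have : (M:ℝ) ≠ 0 := by positivity
  simp
  field_simp

lemma Amat_col (S M s : ℕ) (hM : 0 < M) (h : 1 ≤ s ∧ s ≤ S) (j : Fin (2^S * M)) :
    ∑ i, Amat S M s i j = 1 := by
  rw [← Amat_row S M s hM h j]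
  exact Finset.sum_congr rfl fun i _ => Amat_symm ..

lemma step_const (S M s : ℕ) (hM : 0 < M) (h : 1 ≤ s ∧ s ≤ S) (f : Fin (2^S * M) → ℝ)
    (hf : ∀ i i' : Fin (2^S * M), i.val / M / 2^(s-1) = i'.val / M / 2^(s-1) →
      i.val % M = i'.val % M → f i = f i')
    (i i' : Fin (2^S * M)) (hi : i.val / M / 2^s = i'.val / M / 2^s) :
    ∑ j, Amat S M s i j * f j = ∑ j, Amat S M s i' j * f j := by
  have hs : 2^s = 2^(s-1) * 2 := by rw [← pow_succ]; congr 1; omega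
  have hdiv : ∀ (a : Fin (2^(S-s))) (b : Fin 2) (c : Fin (2^(s-1))) (d : Fin M),
      (d + M * (c + 2^(s-1) * (b + 2 * a)) : ℕ) / M / 2^(s-1) = b + 2 * a := by
    intro a b c d
    rw [Nat.add_mul_div_left _ _ hM, Nat.div_eq_of_lt d.2, zero_add,
      Nat.add_mul_div_left _ _ (by positivity), Nat.div_eq_of_lt c.2, zero_add]
  obtain ⟨⟨⟨⟨a, b⟩, c⟩, d⟩, rfl⟩ := ((aEquiv (2^(S-s)) 2 (2^(s-1)) M).trans
      (finCongr (size_eq S s M h.1 h.2))).surjective i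
  obtain ⟨⟨⟨⟨a', b'⟩, c'⟩, d'⟩, rfl⟩ := ((aEquiv (2^(S-s)) 2 (2^(s-1)) M).trans
      (finCongr (size_eq S s M h.1 h.2))).surjective i'
  rw [e_val S M s h, e_val S M s h, hs, ← Nat.div_div_eq_div_mul, ← Nat.div_div_eq_div_mul (_ / M),
    hdiv, hdiv] at hi
  have ha : a = a' := by apply Fin.ext; omega
  subst ha
  rw [Amat_sum S M s h, Amat_sum S M s h]
  refine Finset.sum_congr rfl fun b _ => Finset.sum_congr rfl fun d _ => ?_
  congr 1
  apply hf
  · rw [e_val S M s h, e_val S M s h, hdiv, hdiv]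
  · rw [e_val S M s h, e_val S M s h]; simp

/-- lack of bias of augmented resampling. Under (A1) (`N = mM`,
`m = 2^S`), with `g` bounded, strictly positive and measurable, for any initial
random sample `ξ_0` the output `ξ_S` of augmented resampling satisfies
`E[(1/N)Σ_i φ(ξ_S^i) | ξ_0] = (Σ_i g(ξ_0^i)φ(ξ_0^i))/(Σ_i g(ξ_0^i))` a.s.
The algorithm is encoded through: the weight recursion `V`; the filtration
`𝒢 s = σ(ξ_0,…,ξ_s)`; the conditional one-step marginals
`ξ_s^i | 𝒢_{s-1} ~ (V_s^i)⁻¹ Σ_j A_s^{ij} V_{s-1}^j δ_{ξ_{s-1}^j}`; and the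
one-step conditional independence of `(ξ_s^i)_i` given `𝒢_{s-1}`. -/
theorem stmt15 (S M : ℕ) (hS : 0 < S) (hM : 0 < M)
    (Ω : Type) (m0 : MeasurableSpace Ω) (μ : Measure Ω) [IsProbabilityMeasure μ]
    (X : Type) (mX : MeasurableSpace X)
    (ξ : ℕ → Fin (2^S * M) → Ω → X) (hξmeas : ∀ s i, Measurable (ξ s i))
    (g : X → ℝ) (hgmeas : Measurable g) (hgpos : ∀ x, 0 < g x)
    (hgbd : ∃ C, ∀ x, g x ≤ C)
    (V : ℕ → Fin (2^S * M) → Ω → ℝ)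
    (hV0 : ∀ i ω, V 0 i ω = g (ξ 0 i ω))
    (hVrec : ∀ s, 1 ≤ s → s ≤ S → ∀ i ω,
      V s i ω = ∑ j, Amat S M s i j * V (s - 1) j ω)
    (𝒢 : ℕ → MeasurableSpace Ω)
    (h𝒢 : ∀ s, 𝒢 s = ⨆ t ∈ Finset.range (s + 1),
      MeasurableSpace.comap (fun ω (i : Fin (2^S * M)) => ξ t i ω) MeasurableSpace.pi)
    (hmarg : ∀ s, 1 ≤ s → s ≤ S → ∀ i, ∀ ψ : X → ℝ, Measurable ψ →
      (∃ C, ∀ x, |ψ x| ≤ C) →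
      μ[(fun ω => ψ (ξ s i ω)) | 𝒢 (s - 1)] =ᵐ[μ]
        fun ω => (V s i ω)⁻¹ * ∑ j, Amat S M s i j * V (s - 1) j ω * ψ (ξ (s - 1) j ω))
    (hci : ∀ s, 1 ≤ s → s ≤ S → ∀ ψ : Fin (2^S * M) → X → ℝ,
      (∀ i, Measurable (ψ i)) → (∀ i, ∃ C, ∀ x, |ψ i x| ≤ C) →
      μ[(fun ω => ∏ i, ψ i (ξ s i ω)) | 𝒢 (s - 1)] =ᵐ[μ]
        fun ω => ∏ i, (μ[(fun ω' => ψ i (ξ s i ω')) | 𝒢 (s - 1)]) ω)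
    (φ : X → ℝ) (hφmeas : Measurable φ) (hφbd : ∃ C, ∀ x, |φ x| ≤ C) :
    μ[(fun ω => (1 / ((2^S * M : ℕ) : ℝ)) * ∑ i, φ (ξ S i ω)) | 𝒢 0] =ᵐ[μ]
      fun ω => (∑ i, g (ξ 0 i ω) * φ (ξ 0 i ω)) / (∑ i, g (ξ 0 i ω)) := by
  obtain ⟨C, hC⟩ := hgbd
  obtain ⟨D, hD⟩ := hφbd
  -- the sigma-algebras
  have hle : ∀ s, 𝒢 s ≤ m0 := by
    intro s
    rw [h𝒢]
    refine iSup₂_le fun t _ => ?_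
    exact (measurable_pi_lambda _ fun i => hξmeas t i).comap_le
  have hmono : ∀ s, 𝒢 0 ≤ 𝒢 s := by
    intro s
    rw [h𝒢 0, h𝒢 s]
    refine biSup_mono fun t ht => ?_
    simp only [Finset.mem_range] at ht ⊢
    omega
  have hmono' : ∀ s, 𝒢 s ≤ 𝒢 (s + 1) := by
    intro s
    rw [h𝒢 s, h𝒢 (s+1)]
    refine biSup_mono fun t ht => ?_
    simp only [Finset.mem_range] at ht ⊢
    omega
  have hξ0 : ∀ i, Measurable[𝒢 0] (ξ 0 i) := by
    intro i
    have h1 : Measurable[MeasurableSpace.comap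
        (fun ω (i : Fin (2^S * M)) => ξ 0 i ω) MeasurableSpace.pi]
        (fun ω (i : Fin (2^S * M)) => ξ 0 i ω) := comap_measurable _
    have h2 := (measurable_pi_apply i).comp h1
    refine Measurable.mono h2 ?_ le_rfl
    rw [h𝒢 0]
    exact le_iSup₂_of_le 0 (by simp) le_rfl
  -- the weights
  have hVmeas : ∀ s, s ≤ S → ∀ i, Measurable[𝒢 0] (V s i) := by
    intro s
    induction s with
    | zero =>
      intro _ i
      have : V 0 i = fun ω => g (ξ 0 i ω) := funext fun ω => hV0 i ω
      rw [this]
      exact hgmeas.comp (hξ0 i)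
    | succ s ih =>
      intro hs i
      have : V (s+1) i = fun ω => ∑ j, Amat S M (s+1) i j * V s j ω :=
        funext fun ω => hVrec (s+1) (by omega) hs i ω
      rw [this]
      exact Finset.measurable_sum _ fun j _ => (ih (by omega) j).const_mul _
  have hVpos : ∀ s, s ≤ S → ∀ i ω, 0 < V s i ω := by
    intro s
    induction s with
    | zero => intro _ i ω; rw [hV0]; exact hgpos _
    | succ s ih =>
      intro hs i ω
      rw [hVrec (s+1) (by omega) hs i ω]
      have hrow := Amat_row S M (s+1) hM ⟨by omega, hs⟩ i
      refine lt_of_le_of_ne (Finset.sum_nonneg fun j _ =>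
        mul_nonneg (Amat_nonneg ..) (ih (by omega) j ω).le) fun h0 => ?_
      have h1 := (Finset.sum_eq_zero_iff_of_nonneg (fun j _ =>
        mul_nonneg (Amat_nonneg S M (s+1) i j) (ih (by omega) j ω).le)).1 h0.symm
      have : ∑ j, Amat S M (s+1) i j = 0 := Finset.sum_eq_zero fun j hj =>
        (mul_eq_zero.1 (h1 j hj)).resolve_right (ih (by omega) j ω).ne'
      rw [hrow] at this
      exact one_ne_zero this
  have hVle : ∀ s, s ≤ S → ∀ i ω, V s i ω ≤ C := by
    intro s
    induction s with
    | zero => intro _ i ω; rw [hV0]; exact hC _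
    | succ s ih =>
      intro hs i ω
      rw [hVrec (s+1) (by omega) hs i ω]
      calc ∑ j, Amat S M (s+1) i j * V s j ω ≤ ∑ j, Amat S M (s+1) i j * C :=
            Finset.sum_le_sum fun j _ =>
              mul_le_mul_of_nonneg_left (ih (by omega) j ω) (Amat_nonneg ..)
        _ = C := by rw [← Finset.sum_mul, Amat_row S M (s+1) hM ⟨by omega, hs⟩ i, one_mul]
  have hVsum : ∀ s, s ≤ S → ∀ ω, ∑ i, V s i ω = ∑ i, g (ξ 0 i ω) := by
    intro s
    induction s with
    | zero => intro _ ω; simp only [hV0]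
    | succ s ih =>
      intro hs ω
      rw [← ih (by omega) ω]
      simp only [fun i => hVrec (s+1) (by omega) hs i ω]
      rw [Finset.sum_comm]
      refine Finset.sum_congr rfl fun j _ => ?_
      rw [← Finset.sum_mul, Amat_col S M (s+1) hM ⟨by omega, hs⟩ j, one_mul]
      rfl
  have hVconst : ∀ s, s ≤ S → ∀ ω, ∀ i i' : Fin (2^S * M),
      i.val / M / 2^s = i'.val / M / 2^s → (s = 0 → i.val % M = i'.val % M) →
      V s i ω = V s i' ω := by
    intro s
    induction s with
    | zero =>
      intro _ ω i i' h1 h2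
      have : i = i' := by
        apply Fin.ext
        rw [← Nat.div_add_mod i.val M, ← Nat.div_add_mod i'.val M, h2 rfl]
        simp only [pow_zero, Nat.div_one] at h1
        rw [h1]
      rw [this]
    | succ s ih =>
      intro hs ω i i' h1 _
      rw [hVrec (s+1) (by omega) hs i ω, hVrec (s+1) (by omega) hs i' ω]
      exact step_const S M (s+1) hM ⟨by omega, hs⟩ (fun j => V s j ω)
        (fun j j' h h' => ih (by omega) ω j j' h fun _ => h') i i' h1
  have hN : (0:ℝ) < ((2^S * M : ℕ) : ℝ) := by
    have : 0 < 2^S * M := by positivity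
    exact_mod_cast this
  have hNpos : 0 < 2^S * M := by positivity
  have hVS : ∀ ω i, ((2^S * M : ℕ) : ℝ) * V S i ω = ∑ j, g (ξ 0 j ω) := by
    intro ω i
    rw [← hVsum S le_rfl ω]
    have : ∀ j, V S j ω = V S i ω := by
      intro j
      refine hVconst S le_rfl ω j i ?_ (by omega)
      rw [Nat.div_div_eq_div_mul, Nat.div_div_eq_div_mul, mul_comm M,
        Nat.div_eq_of_lt j.2, Nat.div_eq_of_lt i.2]
    simp only [this, Finset.sum_const, Finset.card_univ, Fintype.card_fin, nsmul_eq_mul]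
  -- integrability
  have hφint : ∀ s i, Integrable (fun ω => φ (ξ s i ω)) μ := by
    intro s i
    refine Integrable.of_bound (hφmeas.comp (hξmeas s i)).aestronglyMeasurable D
      (Filter.Eventually.of_forall fun ω => ?_)
    exact hD _
  have hVφint : ∀ s, s ≤ S → ∀ i, Integrable (fun ω => V s i ω * φ (ξ s i ω)) μ := by
    intro s hs i
    refine Integrable.bdd_mul (c := C) (hφint s i)
      (((hVmeas s hs i).mono (hle 0) le_rfl).aestronglyMeasurable)
      (Filter.Eventually.of_forall fun ω => ?_)
    rw [Real.norm_eq_abs, abs_of_pos (hVpos s hs i ω)]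
    exact hVle s hs i ω
  -- the martingale
  have hstep : ∀ s, s + 1 ≤ S → μ[(fun ω => ∑ i, V (s+1) i ω * φ (ξ (s+1) i ω)) | 𝒢 s] =ᵐ[μ]
      fun ω => ∑ i, V s i ω * φ (ξ s i ω) := by
    intro s hs
    have e1 : (fun ω => ∑ i, V (s+1) i ω * φ (ξ (s+1) i ω)) =
        ∑ i, (V (s+1) i * fun ω => φ (ξ (s+1) i ω)) := by
      ext ω; simp
    rw [e1]
    have h1 := condExp_finsetSum (μ := μ) (s := Finset.univ)
      (f := fun i => (V (s+1) i * fun ω => φ (ξ (s+1) i ω)))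
      (fun i _ => hVφint (s+1) hs i) (𝒢 s)
    have h2 : ∀ᵐ ω ∂μ, ∀ i, (μ[(V (s+1) i * fun ω => φ (ξ (s+1) i ω)) | 𝒢 s]) ω =
        V (s+1) i ω * (μ[(fun ω => φ (ξ (s+1) i ω)) | 𝒢 s]) ω := by
      rw [ae_all_iff]
      intro i
      exact condExp_mul_of_stronglyMeasurable_left
        ((hVmeas (s+1) hs i).mono (hmono s) le_rfl).stronglyMeasurable
        (hVφint (s+1) hs i) (hφint (s+1) i)
    have h3 : ∀ᵐ ω ∂μ, ∀ i, (μ[(fun ω => φ (ξ (s+1) i ω)) | 𝒢 s]) ω =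
        (V (s+1) i ω)⁻¹ * ∑ j, Amat S M (s+1) i j * V s j ω * φ (ξ s j ω) := by
      rw [ae_all_iff]
      intro i
      exact hmarg (s+1) (by omega) hs i φ hφmeas ⟨D, hD⟩
    filter_upwards [h1, h2, h3] with ω w1 w2 w3
    rw [w1, Finset.sum_apply]
    simp only [w2, w3]
    have : ∀ i, V (s+1) i ω * ((V (s+1) i ω)⁻¹ *
        ∑ j, Amat S M (s+1) i j * V s j ω * φ (ξ s j ω)) =
        ∑ j, Amat S M (s+1) i j * V s j ω * φ (ξ s j ω) := fun i =>
      mul_inv_cancel_left₀ (hVpos (s+1) hs i ω).ne' _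
    simp only [this]
    rw [Finset.sum_comm]
    refine Finset.sum_congr rfl fun j _ => ?_
    simp only [mul_assoc]
    rw [← Finset.sum_mul, Amat_col S M (s+1) hM ⟨by omega, hs⟩ j, one_mul]
  have hmart : ∀ s, s ≤ S → μ[(fun ω => ∑ i, V s i ω * φ (ξ s i ω)) | 𝒢 0] =ᵐ[μ]
      fun ω => ∑ i, V 0 i ω * φ (ξ 0 i ω) := by
    intro s
    induction s with
    | zero =>
      intro hs
      rw [condExp_of_stronglyMeasurable (hle 0)]
      · exact (Finset.measurable_sum _ fun i _ =>
          (hVmeas 0 hs i).mul (hφmeas.comp (hξ0 i))).stronglyMeasurable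
      · exact integrable_finsetSum _ fun i _ => hVφint 0 hs i
    | succ s ih =>
      intro hs
      exact ((condExp_condExp_of_le (hmono s) (hle s)).symm.trans
        (condExp_congr_ae (hstep s hs))).trans (ih (by omega))
  -- conclusion
  have hgsum : ∀ ω, 0 < ∑ j, g (ξ 0 j ω) := by
    intro ω
    rw [← hVS ω ⟨0, hNpos⟩]
    exact mul_pos hN (hVpos S le_rfl _ ω)
  have e2 : (fun ω => (1 / ((2^S * M : ℕ) : ℝ)) * ∑ i, φ (ξ S i ω)) =
      (fun ω => (∑ j, g (ξ 0 j ω))⁻¹) * (fun ω => ∑ i, V S i ω * φ (ξ S i ω)) := by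
    ext ω
    have hv : ∀ i, V S i ω = (∑ j, g (ξ 0 j ω)) / ((2^S * M : ℕ) : ℝ) := by
      intro i
      rw [eq_div_iff hN.ne', mul_comm, hVS]
    simp only [Pi.mul_apply, hv]
    rw [← Finset.mul_sum, ← mul_assoc]
    congr 1
    have := (hgsum ω).ne'
    rw [← mul_div_assoc, inv_mul_cancel₀ this]
  have hZint : Integrable (fun ω => ∑ i, V S i ω * φ (ξ S i ω)) μ :=
    integrable_finsetSum _ fun i _ => hVφint S le_rfl i
  have hint : Integrable (fun ω => (1 / ((2^S * M : ℕ) : ℝ)) * ∑ i, φ (ξ S i ω)) μ :=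
    (integrable_finsetSum _ fun i _ => hφint S i).const_mul _
  have hsm : StronglyMeasurable[𝒢 0] (fun ω => (∑ j, g (ξ 0 j ω))⁻¹) :=
    (Finset.measurable_sum _ fun i _ => hgmeas.comp (hξ0 i)).inv.stronglyMeasurable
  rw [e2] at hint ⊢
  filter_upwards [condExp_mul_of_stronglyMeasurable_left hsm hint hZint, hmart S le_rfl]
    with ω w1 w2
  rw [w1, Pi.mul_apply, w2]
  simp only [hV0]
  rw [div_eq_inv_mul]
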